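/- Let μ = 0 and λ = -2. For any b ∈ ℂ, the ℂ-linear map φ_b on 𝓛 defined by φ_b(Lₙ) = Lₙ + b·n³·Mₙ, φ_b(Yₙ) = Yₙ, φ_b(Mₙ) = Mₙ is a Lie algebra automorphism, with φ_b ∘ φ_{b'} = φ_{b+b'}. -/

import Mathlib

/-- Two linear maps agreeing on three families which together span the domain are equal. -/
theorem LinearMap.eq_of_eqOn_three_families {R V W ι : Type*} [CommRing R] [AddCommGroup V]
    [Module R V] [AddCommGroup W] [Module R W] {L Y M : ι → V}
    (hspan : Submodule.span R (Set.range L ∪ Set.range Y ∪ Set.range M) = ⊤)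
    {f g : V →ₗ[R] W} (hL : ∀ n, f (L n) = g (L n)) (hY : ∀ n, f (Y n) = g (Y n))
    (hM : ∀ n, f (M n) = g (M n)) : f = g := by
  refine LinearMap.ext_on hspan ?_
  rintro _ ((⟨n, rfl⟩ | ⟨n, rfl⟩) | ⟨n, rfl⟩)
  exacts [hL n, hY n, hM n]

/-- The family `b ↦ 1 + b • D` of linear automorphisms attached to a square-zero endomorphism. -/
def LinearEquiv.oneAddSMulOfSqZero {R V : Type*} [CommRing R] [AddCommGroup V] [Module R V]
    (D : V →ₗ[R] V) (hD : ∀ x, D (D x) = 0) (b : R) : V ≃ₗ[R] V :=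
  LinearEquiv.ofLinearMap (LinearMap.id + b • D) (LinearMap.id - b • D)
    (by ext x; simp [hD]) (by ext x; simp [hD])

theorem LinearEquiv.oneAddSMulOfSqZero_apply {R V : Type*} [CommRing R] [AddCommGroup V]
    [Module R V] (D : V →ₗ[R] V) (hD : ∀ x, D (D x) = 0) (b : R) (x : V) :
    LinearEquiv.oneAddSMulOfSqZero D hD b x = x + b • D x := rfl


theorem stmt_19 (𝓛 : Type*) [LieRing 𝓛] [LieAlgebra ℂ 𝓛]
    (L Y M : ℤ → 𝓛)
    (hspan : Submodule.span ℂ (Set.range L ∪ Set.range Y ∪ Set.range M) = ⊤)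
    (hind : LinearIndependent ℂ (fun p : ℤ × Fin 3 =>
      if p.2 = 0 then L p.1 else if p.2 = 1 then Y p.1 else M p.1))
    (hLL : ∀ n m : ℤ, ⁅L n, L m⁆ = ((m : ℂ) - (n : ℂ)) • L (n + m))
    (hLY : ∀ n m : ℤ, ⁅L n, Y m⁆ = ((m : ℂ) + (n : ℂ) / 2) • Y (n + m))
    (hYY : ∀ n m : ℤ, ⁅Y n, Y m⁆ = ((m : ℂ) - (n : ℂ)) • M (n + m))
    (hLM : ∀ n m : ℤ, ⁅L n, M m⁆ = ((m : ℂ) + 2 * (n : ℂ)) • M (n + m))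
    (hYM : ∀ n m : ℤ, ⁅Y n, M m⁆ = 0)
    (hMM : ∀ n m : ℤ, ⁅M n, M m⁆ = 0) :
    ∃ φ : ℂ → (𝓛 ≃ₗ[ℂ] 𝓛),
      (∀ b b' : ℂ, ∀ x : 𝓛, φ (b + b') x = φ b (φ b' x)) ∧
      ∀ b : ℂ,
        (∀ x y : 𝓛, φ b ⁅x, y⁆ = ⁅φ b x, φ b y⁆) ∧
        (∀ n : ℤ, φ b (L n) = L n + (b * (n : ℂ) ^ 3) • M n) ∧
        (∀ n : ℤ, φ b (Y n) = Y n) ∧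
        (∀ n : ℤ, φ b (M n) = M n) := by
  have hspan' : ⊤ ≤ Submodule.span ℂ (Set.range (fun p : ℤ × Fin 3 =>
      if p.2 = 0 then L p.1 else if p.2 = 1 then Y p.1 else M p.1)) := by
    rw [← hspan]
    refine Submodule.span_mono ?_
    rintro _ ((⟨n, rfl⟩ | ⟨n, rfl⟩) | ⟨n, rfl⟩)
    exacts [⟨(n, 0), by simp⟩, ⟨(n, 1), by simp⟩, ⟨(n, 2), by simp⟩]
  let B := Module.Basis.mk hind hspan'
  obtain ⟨D, hDL, hDY, hDM⟩ : ∃ D : 𝓛 →ₗ[ℂ] 𝓛, (∀ n : ℤ, D (L n) = (n : ℂ) ^ 3 • M n) ∧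
      (∀ n, D (Y n) = 0) ∧ ∀ n, D (M n) = 0 := by
    let v : ℤ × Fin 3 → 𝓛 := fun p => if p.2 = 0 then (p.1 : ℂ) ^ 3 • M p.1 else 0
    refine ⟨B.constr ℂ v, fun n => ?_, fun n => ?_, fun n => ?_⟩
    · simpa [B, v] using B.constr_basis ℂ v (n, 0)
    · simpa [B, v] using B.constr_basis ℂ v (n, 1)
    · simpa [B, v] using B.constr_basis ℂ v (n, 2)
  have hDD : ∀ x, D (D x) = 0 := by
    have h : D ∘ₗ D = 0 := LinearMap.eq_of_eqOn_three_families hspan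
      (by simp [hDL, hDM]) (by simp [hDY]) (by simp [hDM])
    exact fun x => LinearMap.congr_fun h x
  let β : 𝓛 →ₗ[ℂ] 𝓛 →ₗ[ℂ] 𝓛 :=
    LinearMap.mk₂ ℂ (fun x y => ⁅x, y⁆) add_lie smul_lie lie_add (fun c x y => lie_smul c x y)
  have hβ : ∀ x y, β x y = ⁅x, y⁆ := fun _ _ => rfl
  have hDbr : ∀ x y, ⁅D x, D y⁆ = 0 := by
    have h : β.compl₁₂ D D = 0 := by
      refine LinearMap.eq_of_eqOn_three_families hspan (fun n => ?_) (fun n => ?_) fun n => ?_ <;>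
      refine LinearMap.eq_of_eqOn_three_families hspan (fun m => ?_) (fun m => ?_) fun m => ?_ <;>
      simp [hβ, hDL, hDY, hDM, hMM]
    exact fun x y => LinearMap.congr_fun₂ h x y
  have hYL : ∀ n m : ℤ, ⁅Y n, L m⁆ = -(((n : ℂ) + (m : ℂ) / 2) • Y (m + n)) := fun n m => by
    rw [← lie_skew, hLY]
  have hML : ∀ n m : ℤ, ⁅M n, L m⁆ = -(((n : ℂ) + 2 * (m : ℂ)) • M (m + n)) := fun n m => by
    rw [← lie_skew, hLM]
  have hMY : ∀ n m : ℤ, ⁅M n, Y m⁆ = 0 := fun n m => by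
    rw [← lie_skew, hYM, neg_zero]
  have hder : ∀ x y, D ⁅x, y⁆ = ⁅D x, y⁆ + ⁅x, D y⁆ := by
    have h : β.compr₂ D = β ∘ₗ D + β.compl₂ D := by
      refine LinearMap.eq_of_eqOn_three_families hspan (fun n => ?_) (fun n => ?_) fun n => ?_ <;>
      refine LinearMap.eq_of_eqOn_three_families hspan (fun m => ?_) (fun m => ?_) fun m => ?_
      · simp only [LinearMap.compr₂_apply, LinearMap.add_apply, LinearMap.comp_apply,
          LinearMap.compl₂_apply, hβ, hDL, hLL, hLM, hML, map_smul, LinearMap.smul_apply, lie_smul,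
          add_comm m n]
        push_cast
        module
      all_goals
        simp [hβ, hDL, hDY, hDM, hLY, hYL, hYY, hLM, hML, hYM, hMY, hMM]
    exact fun x y => LinearMap.congr_fun₂ h x y
  refine ⟨LinearEquiv.oneAddSMulOfSqZero D hDD, fun b b' x => ?_, fun b =>
    ⟨fun x y => ?_, fun n => ?_, fun n => ?_, fun n => ?_⟩⟩ <;>
  simp only [LinearEquiv.oneAddSMulOfSqZero_apply]
  · simp only [map_add, map_smul, hDD]
    module
  · simp only [hder, lie_add, add_lie, smul_lie, lie_smul, hDbr]
    module
  · rw [hDL, smul_smul]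
  · rw [hDY, smul_zero, add_zero]
  · rw [hDM, smul_zero, add_zero]
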